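/- Let (X, σ_X) and (Y, σ_Y) be topologically mixing shifts of finite type, π : X → Y a factor map, α > 0, and φ_n(y) = log |π^{-1}[y_1⋯y_n]|^{1/(α+1)} with Φ = {φ_n}. Then every Gibbs measure ν for Φ is ergodic; indeed there exists C > 0 such that for any two cylinders [i_1⋯i_n] and [j_1⋯j_l] of Y and every k > n + 2M, ν([i_1⋯i_n] ∩ σ_Y^{-k}([j_1⋯j_l])) ≥ C ν([i_1⋯i_n]) ν([j_1⋯j_l]). -/

import Mathlib

set_option linter.unusedSectionVars false
set_option linter.unusedVariables false
set_option maxHeartbeats 1000000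

open MeasureTheory Filter Topology Set
open scoped ENNReal NNReal Classical

namespace Paper

/-- The shift map on the full sequence space over the alphabet `A`. -/
def shiftF (A : Type*) : (ℕ → A) → (ℕ → A) := fun x i => x (i + 1)

/-- A (one-sided) subshift over the alphabet `A`: a closed shift-invariant set of sequences. -/
structure Subshift (A : Type*) [TopologicalSpace A] : Type _ where
  carrier : Set (ℕ → A)
  isClosed : IsClosed carrier
  shift_mem : ∀ x ∈ carrier, shiftF A x ∈ carrier

section Defs

variable {A B : Type*}
  [Fintype A] [TopologicalSpace A] [DiscreteTopology A]
  [MeasurableSpace A] [MeasurableSingletonClass A]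
  [Fintype B] [TopologicalSpace B] [DiscreteTopology B]
  [MeasurableSpace B] [MeasurableSingletonClass B]

/-- The points of a subshift, as a subtype of the full sequence space. -/
abbrev Subshift.pt (X : Subshift A) : Type _ := ↥X.carrier

/-- The shift map of a subshift. -/
def Subshift.σ (X : Subshift A) : X.pt → X.pt :=
  fun x => ⟨shiftF A x.1, X.shift_mem x.1 x.2⟩

/-- `M(X, σ_X)`: the set of shift-invariant Borel probability measures on the subshift. -/
def invP (X : Subshift A) : Set (ProbabilityMeasure X.pt) :=
  {μ | μ.toMeasure.map X.σ = μ.toMeasure}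

/-- The cylinder set `[w₁ ⋯ wₙ]` of a word, inside the subshift. -/
def cyl (X : Subshift A) {n : ℕ} (w : Fin n → A) : Set X.pt :=
  {x | ∀ i : Fin n, x.1 (i : ℕ) = w i}

/-- The entropy of the partition of `X` into cylinders of length `n` w.r.t. `μ`. -/
noncomputable def blockH (X : Subshift A) (μ : ProbabilityMeasure X.pt) (n : ℕ) : ℝ :=
  ∑ w : Fin n → A, Real.negMulLog ((μ.toMeasure (cyl X w)).toReal)

/-- The Kolmogorov–Sinai entropy `h_μ(σ_X)` of an invariant measure on a subshift: for
invariant measures the sequence `blockH` is subadditive, so the infimum below is the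
usual limit `lim (1/n) H_n` over the generating sequence of cylinder partitions. -/
noncomputable def KS (X : Subshift A) (μ : ProbabilityMeasure X.pt) : ℝ :=
  ⨅ n : ℕ, blockH X μ (n + 1) / (n + 1)

/-- A one-block factor map between subshifts, given by a map on symbols. -/
structure Factor (X : Subshift A) (Y : Subshift B) where
  symb : A → B
  mem : ∀ x ∈ X.carrier, (fun i => symb (x i)) ∈ Y.carrier
  surj : ∀ y ∈ Y.carrier, ∃ x ∈ X.carrier, (fun i => symb (x i)) = y

variable {X : Subshift A} {Y : Subshift B}

/-- The factor map `π : X → Y` induced by the one-block map on symbols. -/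
def Factor.map (π : Factor X Y) : X.pt → Y.pt :=
  fun x => ⟨fun i => π.symb (x.1 i), π.mem x.1 x.2⟩

lemma Factor.measurable_map (π : Factor X Y) : Measurable π.map := by
  apply Measurable.subtype_mk
  apply measurable_pi_lambda
  intro i
  exact (measurable_of_countable π.symb).comp
    ((measurable_pi_apply i).comp measurable_subtype_coe)

/-- Push-forward `π μ` of a probability measure under the factor map. -/
noncomputable def Factor.push (π : Factor X Y) (μ : ProbabilityMeasure X.pt) :
    ProbabilityMeasure Y.pt :=
  μ.map π.measurable_map.aemeasurable

/-- A word is allowable in `X` if it occurs (initially) in some point of `X`. -/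
def allowW (X : Subshift A) {n : ℕ} (w : Fin n → A) : Prop :=
  ∃ x ∈ X.carrier, ∀ i : Fin n, x (i : ℕ) = w i

/-- `|π⁻¹[v₁⋯vₙ]|`: the number of allowable `n`-words of `X` mapped by the one-block map
to the word `v`. -/
noncomputable def preCnt (π : Factor X Y) {n : ℕ} (v : Fin n → B) : ℕ :=
  Nat.card {w : Fin n → A // allowW X w ∧ ∀ i, π.symb (w i) = v i}

/-- `|D_n(y)|`: the number of length-`n` cylinders of `X` meeting the fiber `π⁻¹(y)`. -/
noncomputable def Dcnt (π : Factor X Y) (n : ℕ) (y : Y.pt) : ℕ :=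
  Nat.card {w : Fin n → A // ∃ x : X.pt, π.map x = y ∧ ∀ i : Fin n, x.1 (i : ℕ) = w i}

/-- The relative pressure function `P(σ_X, π, 0)(y) = limsup (1/n) log |D_n(y)|`. -/
noncomputable def relP (π : Factor X Y) (y : Y.pt) : ℝ :=
  Filter.limsup (fun n : ℕ => Real.log (Dcnt π n y) / n) Filter.atTop

/-- The function `y ↦ limsup (1/n) log |π⁻¹[y₁⋯yₙ]|`. -/
noncomputable def relP' (π : Factor X Y) (y : Y.pt) : ℝ :=
  Filter.limsup (fun n : ℕ => Real.log (preCnt π (fun i : Fin n => y.1 (i : ℕ))) / n)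
    Filter.atTop

/-- `h_μ(σ) + ∫ f dμ`, as an extended real number. -/
noncomputable def wtF (X : Subshift A) (f : X.pt → ℝ) (μ : ProbabilityMeasure X.pt) : EReal :=
  (KS X μ : EReal) + ((∫ x, f x ∂μ.toMeasure : ℝ) : EReal)

/-- `lim (1/n) ∫ φ_n dμ` for a subadditive sequence `Φ`; for invariant `μ` the limit exists
in `[-∞, ∞)` and equals the infimum below, by subadditivity. -/
noncomputable def potLim (X : Subshift A) (Φ : ℕ → X.pt → ℝ)
    (μ : ProbabilityMeasure X.pt) : EReal :=
  ⨅ n : ℕ, (((∫ x, Φ (n + 1) x ∂μ.toMeasure) / (n + 1) : ℝ) : EReal)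

/-- `h_μ(σ) + ∫ f dμ + lim (1/n) ∫ φ_n dμ`. -/
noncomputable def wtFP (X : Subshift A) (f : X.pt → ℝ) (Φ : ℕ → X.pt → ℝ)
    (μ : ProbabilityMeasure X.pt) : EReal :=
  wtF X f μ + potLim X Φ μ

/-- `h_μ(σ) + lim (1/n) ∫ φ_n dμ`. -/
noncomputable def wtP (X : Subshift A) (Φ : ℕ → X.pt → ℝ)
    (μ : ProbabilityMeasure X.pt) : EReal :=
  (KS X μ : EReal) + potLim X Φ μ

/-- `h_μ(σ) - lim (1/n) ∫ φ_n dμ`: the weight of the superadditive potential `-Φ`,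
for `Φ` subadditive. -/
noncomputable def wtN (X : Subshift A) (Φ : ℕ → X.pt → ℝ)
    (μ : ProbabilityMeasure X.pt) : EReal :=
  (KS X μ : EReal) - potLim X Φ μ

/-- `M_f(X, σ_X)`: equilibrium states of a bounded Borel measurable function `f`. -/
def eqF (X : Subshift A) (f : X.pt → ℝ) : Set (ProbabilityMeasure X.pt) :=
  {μ | μ ∈ invP X ∧ wtF X f μ = sSup (wtF X f '' invP X)}

/-- `M_{f+Φ}(X, σ_X)`: equilibrium states of `f + Φ`, `Φ` a subadditive potential. -/
def eqFP (X : Subshift A) (f : X.pt → ℝ) (Φ : ℕ → X.pt → ℝ) :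
    Set (ProbabilityMeasure X.pt) :=
  {μ | μ ∈ invP X ∧ wtFP X f Φ μ = sSup (wtFP X f Φ '' invP X)}

/-- `M_Φ(X, σ_X)`: equilibrium states of a subadditive potential `Φ`. -/
def eqP (X : Subshift A) (Φ : ℕ → X.pt → ℝ) : Set (ProbabilityMeasure X.pt) :=
  {μ | μ ∈ invP X ∧ wtP X Φ μ = sSup (wtP X Φ '' invP X)}

/-- `M_{-Φ}(X, σ_X)`: equilibrium states of `-Φ`, for `Φ` a subadditive potential. -/
def eqN (X : Subshift A) (Φ : ℕ → X.pt → ℝ) : Set (ProbabilityMeasure X.pt) :=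
  {μ | μ ∈ invP X ∧ wtN X Φ μ = sSup (wtN X Φ '' invP X)}

/-- `μ` is a measure of maximal relative entropy over `m`. -/
def maxRelOver (π : Factor X Y) (m : ProbabilityMeasure Y.pt)
    (μ : ProbabilityMeasure X.pt) : Prop :=
  μ ∈ invP X ∧ π.push μ = m ∧
    KS X μ = sSup (KS X '' {ν | ν ∈ invP X ∧ π.push ν = m})

/-- A subadditive potential: a sequence of continuous functions satisfying the
subadditivity condition (`Φ n` is the paper's `φ_n` for `n ≥ 1`). -/
def SubAdd (X : Subshift A) (Φ : ℕ → X.pt → ℝ) : Prop :=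
  (∀ n : ℕ, 0 < n → Continuous (Φ n)) ∧
  ∀ n m : ℕ, 0 < n → 0 < m → ∀ x : X.pt, Φ (n + m) x ≤ Φ n x + Φ m (X.σ^[n] x)

/-- An almost additive potential. -/
def AlmostAdd (X : Subshift A) (Φ : ℕ → X.pt → ℝ) : Prop :=
  (∀ n : ℕ, 0 < n → Continuous (Φ n)) ∧
  ∃ C : ℝ, 0 < C ∧ ∀ n m : ℕ, 0 < n → 0 < m → ∀ x : X.pt,
    -C + Φ n x + Φ m (X.σ^[n] x) ≤ Φ (n + m) x ∧
    Φ (n + m) x ≤ C + Φ n x + Φ m (X.σ^[n] x)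

/-- The metric on the sequence space: `d(x,y) = (1/2)^k` where `k` is the first index at
which `x` and `y` differ, and `d(x,y) = 0` if `x = y`. -/
noncomputable def dSeq (x y : ℕ → A) : ℝ :=
  if x = y then 0 else (1 / 2 : ℝ) ^ sInf {n : ℕ | x n ≠ y n}

/-- An `(n, ε)`-separated (finite) subset of the subshift. -/
def SepSet (Y : Subshift B) (n : ℕ) (ε : ℝ) (E : Finset Y.pt) : Prop :=
  ∀ x ∈ E, ∀ y ∈ E, x ≠ y → ∃ i < n, ε < dSeq ((Y.σ^[i] x) : Y.pt).1 ((Y.σ^[i] y) : Y.pt).1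

/-- `P_n(σ_Y, Φ, ε)`: the supremum of `∑_{y ∈ E} exp (φ_n y)` over `(n,ε)`-separated
sets `E`. -/
noncomputable def PnV (Y : Subshift B) (Φ : ℕ → Y.pt → ℝ) (n : ℕ) (ε : ℝ) : ℝ :=
  sSup {r : ℝ | ∃ E : Finset Y.pt, SepSet Y n ε E ∧ r = ∑ y ∈ E, Real.exp (Φ n y)}

/-- The subadditive topological pressure `P(σ_Y, Φ) = lim_{ε→0} limsup (1/n) log P_n(σ,Φ,ε)`;
since the inner quantity is monotone as `ε` decreases, the limit as `ε → 0⁺` is the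
supremum over `ε > 0`. -/
noncomputable def Press (Y : Subshift B) (Φ : ℕ → Y.pt → ℝ) : EReal :=
  ⨆ (ε : ℝ) (_ : 0 < ε),
    Filter.limsup (fun n : ℕ => ((Real.log (PnV Y Φ n ε) / n : ℝ) : EReal)) Filter.atTop

/-- `X` is a shift of finite type (a 1-step topological Markov shift). -/
def IsSFT (X : Subshift A) : Prop :=
  ∃ Tr : A → A → Prop, X.carrier = {x | ∀ i : ℕ, Tr (x i) (x (i + 1))}

/-- `X` is irreducible: any two allowable words can be joined by some connecting word. -/
def Irr (X : Subshift A) : Prop :=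
  ∀ (m n : ℕ) (u : Fin m → A) (v : Fin n → A), allowW X u → allowW X v →
    ∃ (k : ℕ) (w : Fin k → A), allowW X (Fin.append (Fin.append u w) v)

/-- `X` is topologically mixing: any two allowable words can be joined by connecting words
of all sufficiently large lengths. -/
def Mix (X : Subshift A) : Prop :=
  ∀ (m n : ℕ) (u : Fin m → A) (v : Fin n → A), allowW X u → allowW X v →
    ∃ N : ℕ, ∀ k ≥ N, ∃ w : Fin k → A, allowW X (Fin.append (Fin.append u w) v)

/-- `M` is a mixing gap for the SFT `X`: any two symbols occurring in `X` are joined by an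
allowable word of length `M + 1` (this encodes `A^M > 0` for the transition matrix `A`). -/
def MixGap (X : Subshift A) (M : ℕ) : Prop :=
  ∀ a b : A, allowW X (fun _ : Fin 1 => a) → allowW X (fun _ : Fin 1 => b) →
    ∃ w : Fin (M + 1) → A, allowW X w ∧ w 0 = a ∧ w (Fin.last M) = b

/-- A Gibbs measure for the sequence of potentials `Φ` on the subshift `Y`: there are
`C > 0` and `P` with `1/C < μ[y₁⋯yₙ] / exp(-nP + φ_n(y)) < C` for all `y` and `n ≥ 1`. -/
def IsGibbs (Y : Subshift B) (Φ : ℕ → Y.pt → ℝ) (μ : ProbabilityMeasure Y.pt) : Prop :=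
  ∃ C : ℝ, 0 < C ∧ ∃ P : ℝ, ∀ n : ℕ, 0 < n → ∀ y : Y.pt,
    1 / C < (μ.toMeasure (cyl Y (fun i : Fin n => y.1 (i : ℕ)))).toReal /
        Real.exp (-(n : ℝ) * P + Φ n y) ∧
      (μ.toMeasure (cyl Y (fun i : Fin n => y.1 (i : ℕ)))).toReal /
        Real.exp (-(n : ℝ) * P + Φ n y) < C

/-- A measure is mixing for the map `f`. -/
def MixingM {Ω : Type*} [MeasurableSpace Ω] (f : Ω → Ω) (μ : Measure Ω) : Prop :=
  ∀ s t : Set Ω, MeasurableSet s → MeasurableSet t →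
    Filter.Tendsto (fun n : ℕ => (μ (s ∩ f^[n] ⁻¹' t)).toReal) Filter.atTop
      (nhds ((μ s).toReal * (μ t).toReal))

/-- The potential `φ_n(y) = log |π⁻¹[y₁⋯yₙ]|^{1/(α+1)}`. -/
noncomputable def phiPre (π : Factor X Y) (α : ℝ) (n : ℕ) (y : Y.pt) : ℝ :=
  Real.log (((preCnt π (fun i : Fin n => y.1 (i : ℕ)) : ℝ)) ^ (1 / (α + 1) : ℝ))

/-- The potential `φ'_n(y) = log |D_n(y)|^{1/(α+1)}`. -/
noncomputable def phiD (π : Factor X Y) (α : ℝ) (n : ℕ) (y : Y.pt) : ℝ :=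
  Real.log (((Dcnt π n y : ℝ)) ^ (1 / (α + 1) : ℝ))

/-- `S_n = ∑_{v ∈ B_n(Y)} |π⁻¹[v]|^{1/(α+1)}` (non-allowable words contribute `0` since
then `|π⁻¹[v]| = 0`). -/
noncomputable def Sval (π : Factor X Y) (α : ℝ) (n : ℕ) : ℝ :=
  ∑ v : Fin n → B, ((preCnt π v : ℝ)) ^ (1 / (α + 1) : ℝ)

/-- `M_{-F∘π + Φ∘π}(X, σ_X)` for `F = P(σ_X, π, 0)` and `Φ` a subadditive potential
on `Y`. -/
noncomputable def compEq (π : Factor X Y) (Φ : ℕ → Y.pt → ℝ) :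
    Set (ProbabilityMeasure X.pt) :=
  eqFP X (fun x => -relP π (π.map x)) (fun n x => Φ n (π.map x))

/-- The weighted entropy functional `h_μ(σ_X) + α h_{πμ}(σ_Y)`. -/
noncomputable def wtAlpha (π : Factor X Y) (α : ℝ) (μ : ProbabilityMeasure X.pt) : EReal :=
  (KS X μ : EReal) + (α : EReal) * (KS Y (π.push μ) : EReal)

/-- `K_α`: the set of invariant measures maximizing `h_μ(σ_X) + α h_{πμ}(σ_Y)`. -/
noncomputable def Kalpha (π : Factor X Y) (α : ℝ) : Set (ProbabilityMeasure X.pt) :=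
  {μ | μ ∈ invP X ∧ wtAlpha π α μ = sSup (wtAlpha π α '' invP X)}

end Defs

/-! ### The torus, the expanding map `T`, and carpets -/

/-- The two-torus. -/
abbrev T2 : Type := AddCircle (1 : ℝ) × AddCircle (1 : ℝ)

/-- The endomorphism `T(x, y) = (l x mod 1, m y mod 1)` of the torus. -/
noncomputable def Tmap (l m : ℕ) : T2 → T2 := fun p => (l • p.1, m • p.2)

/-- The coding map `χ` associated to the Markov partition of `T`. -/
noncomputable def chi (l m : ℕ) (x : ℕ → Fin l × Fin m) : T2 :=
  (((∑' k : ℕ, (((x k).1 : ℕ) : ℝ) / l ^ (k + 1) : ℝ) : AddCircle (1:ℝ)),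
   ((∑' k : ℕ, (((x k).2 : ℕ) : ℝ) / m ^ (k + 1) : ℝ) : AddCircle (1:ℝ)))

/-- The Hausdorff dimension of a measure: the infimum of the Hausdorff dimensions of
sets of full measure. -/
noncomputable def dimHMeas {Ω : Type*} [EMetricSpace Ω] [MeasurableSpace Ω]
    (μ : Measure Ω) : ℝ≥0∞ :=
  ⨅ (s : Set Ω) (_ : μ s = 1), dimH s

/-- `μ` is a `T`-invariant ergodic Borel probability measure of full Hausdorff
dimension for the compact invariant set `K`. -/
def FullDimErg (l m : ℕ) (K : Set T2) (μ : Measure T2) : Prop :=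
  IsProbabilityMeasure μ ∧ Ergodic (Tmap l m) μ ∧ μ K = 1 ∧ dimHMeas μ = dimH K

/-- The coding map restricted to a carpet subshift. -/
noncomputable def chiPt {l m : ℕ} (X : Subshift (Fin l × Fin m)) (x : X.pt) : T2 :=
  chi l m x.1


section Aux

variable {A B : Type*}
  [Fintype A] [TopologicalSpace A] [DiscreteTopology A]
  [MeasurableSpace A] [MeasurableSingletonClass A]
  [Fintype B] [TopologicalSpace B] [DiscreteTopology B]
  [MeasurableSpace B] [MeasurableSingletonClass B]

/-- Initial block of a point. -/
def pref (Y : Subshift B) (N : ℕ) (y : Y.pt) : Fin N → B := fun i => y.1 (i : ℕ)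

lemma measurable_pref (Y : Subshift B) (N : ℕ) : Measurable (pref Y N) := by
  apply measurable_pi_lambda
  intro i
  exact (measurable_pi_apply _).comp measurable_subtype_coe

lemma cyl_eq (Y : Subshift B) {N : ℕ} (w : Fin N → B) : cyl Y w = pref Y N ⁻¹' {w} := by
  ext y
  simp [cyl, pref, funext_iff]

lemma measurable_cyl (Y : Subshift B) {N : ℕ} (w : Fin N → B) : MeasurableSet (cyl Y w) := by
  rw [cyl_eq]
  exact measurable_pref Y N (measurableSet_singleton _)

lemma meas_pref (Y : Subshift B) (μ : Measure Y.pt) (N : ℕ) (S : Finset (Fin N → B)) :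
    μ (pref Y N ⁻¹' (S : Set (Fin N → B))) = ∑ W ∈ S, μ (cyl Y W) := by
  simp only [cyl_eq]
  exact (sum_measure_preimage_singleton S
    (fun W _ => measurable_pref Y N (measurableSet_singleton _))).symm

lemma measurable_σ (Y : Subshift B) : Measurable Y.σ := by
  apply Measurable.subtype_mk
  apply measurable_pi_lambda
  intro i
  exact (measurable_pi_apply _).comp measurable_subtype_coe

lemma σ_iter (Y : Subshift B) (k : ℕ) (y : Y.pt) (i : ℕ) : (Y.σ^[k] y).1 i = y.1 (k + i) := by
  induction k generalizing y with
  | zero => simp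
  | succ k ih =>
    rw [Function.iterate_succ_apply, ih]
    show y.1 (k + i + 1) = y.1 (k + 1 + i)
    rw [show k + i + 1 = k + 1 + i by omega]

/-- The ring of clopen sets. -/
def cylRing (Y : Subshift B) : Set (Set Y.pt) :=
  {s | ∃ (N : ℕ) (S : Set (Fin N → B)), s = pref Y N ⁻¹' S}

lemma pref_lift (Y : Subshift B) {N N' : ℕ} (h : N ≤ N') (S : Set (Fin N → B)) :
    pref Y N ⁻¹' S = pref Y N' ⁻¹' {w | (fun i : Fin N => w (Fin.castLE h i)) ∈ S} := rfl

lemma isSetRing_cylRing (Y : Subshift B) : IsSetRing (cylRing Y) where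
  empty_mem := ⟨0, ∅, by simp⟩
  union_mem := by
    rintro _ _ ⟨N, S, rfl⟩ ⟨N', S', rfl⟩
    rw [pref_lift Y (le_max_left N N') S, pref_lift Y (le_max_right N N') S']
    exact ⟨_, _, preimage_union.symm⟩
  sdiff_mem := by
    rintro _ _ ⟨N, S, rfl⟩ ⟨N', S', rfl⟩
    rw [pref_lift Y (le_max_left N N') S, pref_lift Y (le_max_right N N') S']
    exact ⟨_, _, (preimage_diff _ _ _).symm⟩

lemma generate_cylRing (Y : Subshift B) :
    (inferInstance : MeasurableSpace Y.pt) = MeasurableSpace.generateFrom (cylRing Y) := by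
  apply le_antisymm
  · intro s hs
    have key : @Measurable _ _ (MeasurableSpace.generateFrom (cylRing Y)) inferInstance
        (Subtype.val : Y.pt → (ℕ → B)) := by
      refine @measurable_pi_lambda _ _ _ (_) _ _ ?_
      intro i S _
      apply MeasurableSpace.measurableSet_generateFrom
      exact ⟨i + 1, {w | w (Fin.last i) ∈ S}, rfl⟩
    obtain ⟨t, ht, rfl⟩ := hs
    exact key ht
  · apply MeasurableSpace.generateFrom_le
    rintro _ ⟨N, S, rfl⟩
    exact measurable_pref Y N S.toFinite.measurableSet

open scoped symmDiff in
lemma meas_le_of_cyl (Y : Subshift B) (μ₁ μ₂ : Measure Y.pt) [IsFiniteMeasure μ₁]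
    [IsFiniteMeasure μ₂]
    (h : ∀ (N : ℕ) (w : Fin N → B), μ₁ (cyl Y w) ≤ μ₂ (cyl Y w))
    {s : Set Y.pt} (hs : MeasurableSet s) : μ₁ s ≤ μ₂ s := by
  have hC : ∀ t ∈ cylRing Y, μ₁ t ≤ μ₂ t := by
    rintro _ ⟨N, S, rfl⟩
    have : S = (S.toFinite.toFinset : Set (Fin N → B)) := by simp
    rw [this, meas_pref, meas_pref]
    exact Finset.sum_le_sum fun W _ => h N W
  apply ENNReal.le_of_forall_pos_le_add
  intro ε hε _
  obtain ⟨t, htC, ht⟩ := exists_measure_symmDiff_lt_of_generateFrom_isSetRing (μ := μ₁ + μ₂)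
    (isSetRing_cylRing Y) ⟨{univ}, by simp, by
      rintro _ rfl
      exact ⟨0, univ, by simp⟩, by simp⟩ (generate_cylRing Y) hs
    (ε := ε) (by simpa using hε)
  have h1 : μ₁ s ≤ μ₁ t + μ₁ (t ∆ s) := by
    refine (measure_mono ?_).trans (measure_union_le _ _)
    intro x hx
    by_cases hxt : x ∈ t
    · exact Or.inl hxt
    · exact Or.inr (Or.inr ⟨hx, hxt⟩)
  have h2 : μ₂ t ≤ μ₂ s + μ₂ (t ∆ s) := by
    refine (measure_mono ?_).trans (measure_union_le _ _)
    intro x hx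
    by_cases hxt : x ∈ s
    · exact Or.inl hxt
    · exact Or.inr (Or.inl ⟨hx, hxt⟩)
  calc μ₁ s ≤ μ₁ t + μ₁ (t ∆ s) := h1
    _ ≤ (μ₂ s + μ₂ (t ∆ s)) + μ₁ (t ∆ s) := by
      gcongr
      exact (hC t htC).trans h2
    _ = μ₂ s + (μ₁ + μ₂) (t ∆ s) := by
      rw [Measure.add_apply, add_assoc, add_comm (μ₁ _)]
    _ ≤ μ₂ s + ε := by gcongr

lemma glue {X : Subshift A} (hXS : IsSFT X) (m : ℕ) (hM : MixGap X (m + 1))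
    (p p' : ℕ → A) (hp : p ∈ X.carrier) (hp' : p' ∈ X.carrier) (n : ℕ) :
    ∃ s ∈ X.carrier, (∀ i < n, s i = p i) ∧ ∀ j, s (n + m + j) = p' j := by
  obtain ⟨Tr, hTr⟩ := hXS
  have shift : ∀ (k : ℕ), ∀ x ∈ X.carrier, (fun i => x (i + k)) ∈ X.carrier := by
    intro k x hx
    rw [hTr] at hx ⊢
    intro i
    have := hx (i + k)
    rwa [show i + k + 1 = i + 1 + k by omega] at this
  have main : ∀ n, ∃ s ∈ X.carrier, (∀ i < n + 1, s i = p i) ∧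
      ∀ j, s (n + 1 + m + j) = p' j := by
    intro n
    obtain ⟨w, ⟨c, hc, hcw⟩, hw0, hw1⟩ := hM (p n) (p' 0)
      ⟨_, shift n p hp, by intro i; simp⟩ ⟨p', hp', by intro i; simp⟩
    have hc0 : c 0 = p n := by rw [← hw0]; exact hcw 0
    have hc1 : c (m + 1) = p' 0 := by rw [← hw1]; exact hcw (Fin.last (m + 1))
    rw [hTr] at hp hp' hc
    refine ⟨fun i => if i ≤ n then p i else if i ≤ n + m + 1 then c (i - n)
      else p' (i - (n + m + 1)), ?_, ?_, ?_⟩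
    · rw [hTr]
      intro i
      dsimp only
      by_cases h1 : i + 1 ≤ n
      · rw [if_pos h1, if_pos (by omega)]
        exact hp i
      rw [if_neg h1]
      by_cases h2 : i + 1 ≤ n + m + 1
      · rw [if_pos h2]
        by_cases h3 : i ≤ n
        · have : i = n := by omega
          subst this
          rw [if_pos h3, ← hc0, show i + 1 - i = 0 + 1 by omega]
          exact hc 0
        · rw [if_neg h3, if_pos (by omega), show i + 1 - n = i - n + 1 by omega]
          exact hc _
      · rw [if_neg h2, if_neg (by omega)]
        by_cases h3 : i ≤ n + m + 1
        · have : i = n + m + 1 := by omega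
          subst this
          rw [if_pos h3, show n + m + 1 - n = m + 1 by omega, hc1,
            show n + m + 1 + 1 - (n + m + 1) = 0 + 1 by omega]
          exact hp' 0
        · rw [if_neg h3, show i + 1 - (n + m + 1) = i - (n + m + 1) + 1 by omega]
          exact hp' _
    · intro i hi
      exact if_pos (by omega)
    · intro j
      dsimp only
      rw [if_neg (by omega)]
      by_cases hj : j = 0
      · subst hj
        rw [if_pos (by omega), show n + 1 + m + 0 - n = m + 1 by omega, hc1]
      · rw [if_neg (by omega), show n + 1 + m + j - (n + m + 1) = j by omega]
  cases n with
  | succ n => exact main n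
  | zero =>
    obtain ⟨s, hs, h1, h2⟩ := main 0
    refine ⟨_, shift 1 s hs, by simp, ?_⟩
    intro j
    rw [← h2 j]
    congr 1; omega

variable {X : Subshift A} {Y : Subshift B}

/-- Words of length `k + l` beginning with `u`, with `z` at place `n + m` and `v` at place `k`. -/
noncomputable def goodW (m : ℕ) {n q l : ℕ} (u : Fin n → B) (z : Fin q → B) (v : Fin l → B) :
    Finset (Fin (n + m + (q + m + l)) → B) :=
  Finset.univ.filter fun W =>
    (∀ i : Fin n, W ⟨i, by omega⟩ = u i) ∧ (∀ i : Fin q, W ⟨n + m + i, by omega⟩ = z i) ∧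
    (∀ i : Fin l, W ⟨n + m + (q + m + i), by omega⟩ = v i)

lemma count_mul (π : Factor X Y) (hXS : IsSFT X) (m : ℕ) (hM : MixGap X (m + 1))
    {n q l : ℕ} (u : Fin n → B) (z : Fin q → B) (v : Fin l → B) :
    preCnt π u * preCnt π z * preCnt π v ≤ ∑ W ∈ goodW m u z v, preCnt π W := by
  unfold preCnt
  rw [← Finset.sum_coe_sort, ← Nat.card_sigma, ← Nat.card_prod, ← Nat.card_prod]
  refine Nat.card_le_card_of_surjective (fun w => 
    ((⟨fun i : Fin n => w.2.1 ⟨i, by omega⟩, ?_, ?_⟩,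
      ⟨fun i : Fin q => w.2.1 ⟨n + m + i, by omega⟩, ?_, ?_⟩), 
      ⟨fun i : Fin l => w.2.1 ⟨n + m + (q + m + i), by omega⟩, ?_, ?_⟩)) ?_
  · obtain ⟨x, hx, h⟩ := w.2.2.1
    exact ⟨x, hx, fun i => h ⟨i, by omega⟩⟩
  · intro i
    have := (Finset.mem_filter.1 w.1.2).2.1 i
    rw [← this]
    exact w.2.2.2 _
  · obtain ⟨x, hx, h⟩ := w.2.2.1
    refine ⟨X.σ^[n + m] ⟨x, hx⟩, Subtype.prop _, fun i => ?_⟩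
    rw [σ_iter]
    exact h ⟨n + m + i, by omega⟩
  · intro i
    have := (Finset.mem_filter.1 w.1.2).2.2.1 i
    rw [← this]
    exact w.2.2.2 _
  · obtain ⟨x, hx, h⟩ := w.2.2.1
    refine ⟨X.σ^[n + m + (q + m)] ⟨x, hx⟩, Subtype.prop _, fun i => ?_⟩
    rw [σ_iter]
    rw [show n + m + (q + m) + (i : ℕ) = n + m + (q + m + i) by omega]
    exact h ⟨n + m + (q + m + i), by omega⟩
  · intro i
    have := (Finset.mem_filter.1 w.1.2).2.2.2 i
    rw [← this]
    exact w.2.2.2 _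
  · rintro ⟨⟨⟨a, ⟨x, hx, hxa⟩, ha⟩, ⟨b, ⟨y, hy, hyb⟩, hb⟩⟩, ⟨c, ⟨t, ht, htc⟩, hc⟩⟩
    obtain ⟨r, hr, hr1, hr2⟩ := glue hXS m hM y t hy ht q
    obtain ⟨s, hs, hs1, hs2⟩ := glue hXS m hM x r hx hr n
    have e1 : ∀ i : Fin n, s i = a i := fun i => (hs1 i i.2).trans (hxa i)
    have e2 : ∀ i : Fin q, s (n + m + i) = b i := fun i =>
      (hs2 i).trans ((hr1 i i.2).trans (hyb i))
    have e3 : ∀ i : Fin l, s (n + m + (q + m + i)) = c i := fun i =>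
      (hs2 _).trans ((hr2 i).trans (htc i))
    refine ⟨⟨⟨fun i => π.symb (s i), ?_⟩, ⟨fun i => s i, ⟨s, hs, fun _ => rfl⟩, fun _ => rfl⟩⟩, ?_⟩
    · rw [goodW, Finset.mem_filter]
      refine ⟨Finset.mem_univ _, fun i => ?_, fun i => ?_, fun i => ?_⟩
      · simp [e1, ha]
      · simp [e2, hb]
      · simp [e3, hc]
    · simp only [Prod.mk.injEq, Subtype.mk.injEq]
      exact ⟨⟨funext e1, funext e2⟩, funext e3⟩

lemma rpow_sum_le' {ι : Type*} (F : Finset ι) (f : ι → ℝ) (hf : ∀ i, 0 ≤ f i) {b : ℝ}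
    (hb0 : 0 < b) (hb1 : b ≤ 1) : (∑ i ∈ F, f i) ^ b ≤ ∑ i ∈ F, f i ^ b := by
  induction F using Finset.induction_on with
  | empty => simp [Real.zero_rpow hb0.ne']
  | insert i F hi ih =>
    rw [Finset.sum_insert hi, Finset.sum_insert hi]
    refine (Real.rpow_add_le_add_rpow (hf i) (Finset.sum_nonneg fun i _ => hf i)
      hb0.le hb1).trans ?_
    gcongr

lemma gibbs_word (π : Factor X Y) {α : ℝ} (hα : 0 < α) (ν : ProbabilityMeasure Y.pt)
    (hG : IsGibbs Y (phiPre π α) ν) :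
    ∃ C : ℝ, 1 ≤ C ∧ ∃ P : ℝ, ∀ (n : ℕ) (v : Fin n → B),
      (ν.toMeasure (cyl Y v)).toReal ≤
        C * (Real.exp (-(n : ℝ) * P) * (preCnt π v : ℝ) ^ (1 / (α + 1))) ∧
      Real.exp (-(n : ℝ) * P) * (preCnt π v : ℝ) ^ (1 / (α + 1)) ≤
        C * (ν.toMeasure (cyl Y v)).toReal := by
  obtain ⟨C, hC, P, h⟩ := hG
  obtain ⟨y₀⟩ : Nonempty Y.pt := ν.toMeasure.nonempty_of_neZero
  have hb : (0 : ℝ) < 1 / (α + 1) := by positivity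
  have hC1 : 1 ≤ C := by
    have := (h 1 one_pos y₀).1.trans (h 1 one_pos y₀).2
    rw [div_lt_iff₀ hC] at this
    nlinarith
  refine ⟨C, hC1, P, fun n v => ?_⟩
  by_cases hv : allowW Y v
  · obtain ⟨y, hy, hyv⟩ := hv
    obtain rfl : v = fun i : Fin n => y i := funext fun i => (hyv i).symm
    have hpos : 0 < preCnt π (fun i : Fin n => y i) := by
      obtain ⟨x, hx, hxy⟩ := π.surj y hy
      unfold preCnt
      have : Nonempty {w : Fin n → A // allowW X w ∧ ∀ i, π.symb (w i) = y i} :=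
        ⟨fun i => x i, ⟨x, hx, fun _ => rfl⟩, fun i => congrFun hxy i⟩
      exact Nat.card_pos
    rcases Nat.eq_zero_or_pos n with rfl | hn
    · have h1 : cyl Y (fun i : Fin 0 => y i) = univ := by
        ext; simp [cyl]
      have h2 : preCnt π (fun i : Fin 0 => y i) = 1 := by
        apply le_antisymm _ hpos
        unfold preCnt
        exact Finite.card_le_one_iff_subsingleton.2 inferInstance
      rw [h1, h2]
      simp [hC1]
    · have h3 := h n hn ⟨y, hy⟩
      have e : Real.exp (-(n : ℝ) * P + phiPre π α n ⟨y, hy⟩) =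
          Real.exp (-(n : ℝ) * P) * (preCnt π (fun i : Fin n => y i) : ℝ) ^ (1 / (α + 1)) := by
        rw [Real.exp_add, phiPre, Real.exp_log]
        exact Real.rpow_pos_of_pos (by exact_mod_cast hpos) _
      have hp : 0 < Real.exp (-(n : ℝ) * P) *
          (preCnt π (fun i : Fin n => y i) : ℝ) ^ (1 / (α + 1)) := by
        rw [← e]; exact Real.exp_pos _
      rw [e] at h3
      constructor
      · exact ((div_lt_iff₀ hp).1 h3.2).le
      · have := (lt_div_iff₀ hp).1 h3.1
        rw [one_div, inv_mul_lt_iff₀ hC] at this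
        exact this.le
  · have h1 : cyl Y v = ∅ := by
      ext y
      simp only [mem_empty_iff_false, iff_false]
      exact fun hy => hv ⟨y.1, y.2, hy⟩
    have h2 : preCnt π v = 0 := by
      unfold preCnt
      rw [Nat.card_eq_zero]
      left
      constructor
      rintro ⟨w, ⟨x, hx, hxw⟩, hw⟩
      exact hv ⟨_, π.mem x hx, fun i => by rw [hxw, hw]⟩
    rw [h1, h2, Nat.cast_zero, Real.zero_rpow hb.ne']
    simp

lemma goodW_disj (m : ℕ) {n q l : ℕ} (u : Fin n → B) (v : Fin l → B) :
    ((Finset.univ : Finset (Fin q → B)) : Set (Fin q → B)).PairwiseDisjoint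
      (fun z => goodW m u z v) := by
  intro z _ z' _ hzz
  rw [Function.onFun, Finset.disjoint_left]
  intro W h h'
  apply hzz
  ext i
  rw [goodW, Finset.mem_filter] at h h'
  rw [← h.2.2.1, ← h'.2.2.1]

lemma corr (π : Factor X Y) (hXS : IsSFT X) (m : ℕ) (hM : MixGap X (m + 1))
    {α : ℝ} (hα : 0 < α) (ν : ProbabilityMeasure Y.pt) (hG : IsGibbs Y (phiPre π α) ν) :
    ∃ D : ℝ, 0 < D ∧ ∀ (n q l : ℕ) (u : Fin n → B) (v : Fin l → B),
      D * ((ν.toMeasure (cyl Y u)).toReal * (ν.toMeasure (cyl Y v)).toReal)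
        ≤ (ν.toMeasure (cyl Y u ∩ Y.σ^[n + m + (q + m)] ⁻¹' cyl Y v)).toReal := by
  obtain ⟨C, hC1, P, hg⟩ := gibbs_word π hα ν hG
  have hC : 0 < C := by linarith
  have hb : (0 : ℝ) < 1 / (α + 1) := by positivity
  have hb1 : 1 / (α + 1) ≤ (1 : ℝ) := by
    rw [div_le_one (by positivity)]; linarith
  set b := 1 / (α + 1) with hbdef
  refine ⟨Real.exp (-(2 * m : ℝ) * P) / C ^ 4, by positivity, fun n q l u v => ?_⟩
  set N := n + m + (q + m + l) with hN
  set S := Finset.univ.biUnion (fun z : Fin q → B => goodW m u z v) with hS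
  have hsub : pref Y N ⁻¹' (S : Set (Fin N → B)) ⊆
      cyl Y u ∩ Y.σ^[n + m + (q + m)] ⁻¹' cyl Y v := by
    intro y hy
    have hy' : pref Y N y ∈ S := hy
    rw [hS, Finset.mem_biUnion] at hy'
    obtain ⟨z, _, hz⟩ := hy'
    rw [goodW, Finset.mem_filter] at hz
    refine ⟨fun i => hz.2.1 i, fun i => ?_⟩
    rw [σ_iter, ← hz.2.2.2 i]
    show y.1 (n + m + (q + m) + (i : ℕ)) = y.1 (n + m + (q + m + (i : ℕ)))
    rw [show n + m + (q + m) + (i : ℕ) = n + m + (q + m + (i : ℕ)) by omega]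
  have key : ∀ z : Fin q → B,
      ((preCnt π u : ℝ) * preCnt π z * preCnt π v) ^ b ≤
        ∑ W ∈ goodW m u z v, (preCnt π W : ℝ) ^ b := by
    intro z
    refine le_trans ?_ (rpow_sum_le' _ _ (fun _ => Nat.cast_nonneg _) hb hb1)
    apply Real.rpow_le_rpow (by positivity) _ hb.le
    exact_mod_cast count_mul π hXS m hM u z v
  have hone : (1 : ℝ) = ∑ z : Fin q → B, (ν.toMeasure (cyl Y z)).toReal := by
    have := meas_pref Y ν.toMeasure q Finset.univ
    simp only [Finset.coe_univ, preimage_univ, measure_univ] at this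
    rw [← ENNReal.toReal_sum (fun _ _ => measure_ne_top _ _), ← this]
    simp
  have hexp : Real.exp (-(N : ℝ) * P) = Real.exp (-(2 * m : ℝ) * P) *
      Real.exp (-(n : ℝ) * P) * Real.exp (-(q : ℝ) * P) * Real.exp (-(l : ℝ) * P) := by
    rw [← Real.exp_add, ← Real.exp_add, ← Real.exp_add, hN]
    congr 1
    push_cast
    ring
  have hcyl : ∀ z : Fin q → B, Real.exp (-(2 * m : ℝ) * P) / C ^ 3 *
      ((ν.toMeasure (cyl Y u)).toReal * (ν.toMeasure (cyl Y v)).toReal) *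
        (ν.toMeasure (cyl Y z)).toReal ≤
      Real.exp (-(N : ℝ) * P) * ∑ W ∈ goodW m u z v, (preCnt π W : ℝ) ^ b := by
    intro z
    have h1 := (hg n u).1
    have h2 := (hg q z).1
    have h3 := (hg l v).1
    calc _ ≤ Real.exp (-(2 * m : ℝ) * P) / C ^ 3 *
          ((C * (Real.exp (-(n : ℝ) * P) * (preCnt π u : ℝ) ^ b)) *
            (C * (Real.exp (-(l : ℝ) * P) * (preCnt π v : ℝ) ^ b))) *
            (C * (Real.exp (-(q : ℝ) * P) * (preCnt π z : ℝ) ^ b)) := by gcongr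
      _ = Real.exp (-(N : ℝ) * P) * ((preCnt π u : ℝ) * preCnt π z * preCnt π v) ^ b := by
        rw [hexp, Real.mul_rpow (by positivity) (by positivity),
          Real.mul_rpow (by positivity) (by positivity)]
        field_simp
      _ ≤ _ := by gcongr; exact key z
  calc Real.exp (-(2 * m : ℝ) * P) / C ^ 4 *
        ((ν.toMeasure (cyl Y u)).toReal * (ν.toMeasure (cyl Y v)).toReal)
      = (1 / C) * ∑ z : Fin q → B, Real.exp (-(2 * m : ℝ) * P) / C ^ 3 *
      ((ν.toMeasure (cyl Y u)).toReal * (ν.toMeasure (cyl Y v)).toReal) *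
        (ν.toMeasure (cyl Y z)).toReal := by
        rw [← Finset.mul_sum, ← hone]
        field_simp
    _ ≤ (1 / C) * ∑ z : Fin q → B,
        Real.exp (-(N : ℝ) * P) * ∑ W ∈ goodW m u z v, (preCnt π W : ℝ) ^ b := by
        refine mul_le_mul_of_nonneg_left ?_ (by positivity)
        exact Finset.sum_le_sum fun z _ => hcyl z
    _ = (1 / C) * ∑ W ∈ S, Real.exp (-(N : ℝ) * P) * (preCnt π W : ℝ) ^ b := by
        rw [hS, Finset.sum_biUnion (goodW_disj m u v)]
        simp only [Finset.mul_sum]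
    _ ≤ (1 / C) * ∑ W ∈ S, C * (ν.toMeasure (cyl Y W)).toReal := by
        refine mul_le_mul_of_nonneg_left ?_ (by positivity)
        exact Finset.sum_le_sum fun W _ => (hg N W).2
    _ = (ν.toMeasure (pref Y N ⁻¹' (S : Set (Fin N → B)))).toReal := by
        rw [← Finset.mul_sum, meas_pref, ENNReal.toReal_sum (fun _ _ => measure_ne_top _ _)]
        field_simp
        rfl
    _ ≤ _ := ENNReal.toReal_mono (measure_ne_top _ _) (measure_mono hsub)

lemma mixGap_one (hM : MixGap X 0) : MixGap X 1 := by
  intro a b ha hb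
  obtain ⟨w, -, h0, h1⟩ := hM a b ha hb
  obtain ⟨x, hx, hxa⟩ := ha
  have hx0 : x 0 = a := hxa 0
  have hb1 : allowW X (fun _ : Fin 1 => x 1) :=
    ⟨_, X.shift_mem x hx, fun i => by simp [shiftF]⟩
  obtain ⟨w', -, h0', h1'⟩ := hM a (x 1) ⟨x, hx, hxa⟩ hb1
  have e : b = a := by rw [← h1, ← h0]; rfl
  have e' : x 1 = a := by rw [← h1', ← h0']; rfl
  refine ⟨fun i => x i, ⟨x, hx, fun _ => rfl⟩, hx0, ?_⟩
  rw [e, ← e']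
  rfl

lemma preErg (ν : ProbabilityMeasure Y.pt) (D : ℝ) (hD : 0 < D) (M : ℕ)
    (h : ∀ (n l : ℕ) (u : Fin n → B) (v : Fin l → B), 
        ∀ k : ℕ, n + 2 * M < k →
          D * ((ν.toMeasure (cyl Y u)).toReal * (ν.toMeasure (cyl Y v)).toReal)
            ≤ (ν.toMeasure (cyl Y u ∩ Y.σ^[k] ⁻¹' cyl Y v)).toReal) :
    PreErgodic Y.σ ν.toMeasure := by
  set μ := ν.toMeasure with hμ
  set d := ENNReal.ofReal D with hd
  have hd0 : d ≠ 0 := by simpa [hd] using hD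
  have h' : ∀ (n l : ℕ) (u : Fin n → B) (v : Fin l → B), 
        ∀ k : ℕ, n + 2 * M < k →
          d * μ (cyl Y u) * μ (cyl Y v) ≤ μ (cyl Y u ∩ Y.σ^[k] ⁻¹' cyl Y v) := by
    intro n l u v k hk
    rw [← ENNReal.toReal_le_toReal (by finiteness) (by finiteness)]
    have := h n l u v k hk
    rw [ENNReal.toReal_mul, ENNReal.toReal_mul, hd, ENNReal.toReal_ofReal hD.le, mul_assoc]
    exact this
  constructor
  intro s hs hinv
  have hiter : ∀ k, Y.σ^[k] ⁻¹' s = s := by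
    intro k
    induction k with
    | zero => rfl
    | succ k ih => rw [Function.iterate_succ, preimage_comp, ih, hinv]
  have step1 : ∀ (n : ℕ) (u : Fin n → B), d * μ (cyl Y u) * μ s ≤ μ (cyl Y u ∩ s) := by
    intro n u
    set k := n + 2 * M + 1
    have hmk : Measurable (Y.σ^[k]) := (measurable_σ Y).iterate k
    have hfin : IsFiniteMeasure ((d * μ (cyl Y u)) • μ) :=
      Measure.smul_finite _ (by finiteness)
    have := meas_le_of_cyl Y ((d * μ (cyl Y u)) • μ) ((μ.restrict (cyl Y u)).map Y.σ^[k])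
      (fun l v => by
        rw [Measure.map_apply hmk (measurable_cyl Y v),
          Measure.restrict_apply (hmk (measurable_cyl Y v)), inter_comm]
        exact h' n l u v k (by omega)) hs
    rw [Measure.map_apply hmk hs, hiter, Measure.restrict_apply hs, inter_comm] at this
    exact this
  have hfin : IsFiniteMeasure ((d * μ s) • μ) := Measure.smul_finite _ (by finiteness)
  have step2 := meas_le_of_cyl Y ((d * μ s) • μ) (μ.restrict s)
    (fun n u => by
      rw [Measure.restrict_apply (measurable_cyl Y u), Measure.smul_apply, smul_eq_mul,
        mul_right_comm]
      exact step1 n u) hs.compl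
  rw [Measure.restrict_apply hs.compl, compl_inter_self, measure_empty, Measure.smul_apply,
    smul_eq_mul, nonpos_iff_eq_zero, mul_eq_zero, mul_eq_zero] at step2
  rw [eventuallyConst_set]
  rcases step2 with (h0 | h0) | h0
  · exact absurd h0 hd0
  · right
    rw [ae_iff]; simpa using h0
  · left
    rw [ae_iff]; exact h0

end Aux

/-- Lemma: every Gibbs measure for `Φ = {φ_n}`,
`φ_n(y) = log |π⁻¹[y₁⋯yₙ]|^{1/(α+1)}`, is ergodic; with the explicit correlation bound
`ν([u] ∩ σ_Y^{-k}[v]) ≥ C ν([u]) ν([v])` for `k > n + 2M`. -/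
theorem statement17
    {A B : Type*}
    [Fintype A] [TopologicalSpace A] [DiscreteTopology A]
    [MeasurableSpace A] [MeasurableSingletonClass A]
    [Fintype B] [TopologicalSpace B] [DiscreteTopology B]
    [MeasurableSpace B] [MeasurableSingletonClass B]
    (X : Subshift A) (Y : Subshift B) (π : Factor X Y)
    (hXS : IsSFT X) (hYS : IsSFT Y) (hXM : Mix X) (hYM : Mix Y)
    (M : ℕ) (hM : MixGap X M)
    (α : ℝ) (hα : 0 < α)
    (ν : ProbabilityMeasure Y.pt) (hG : IsGibbs Y (phiPre π α) ν) :
    (∃ C : ℝ, 0 < C ∧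
      ∀ (n l : ℕ) (u : Fin n → B) (v : Fin l → B), allowW Y u → allowW Y v →
        ∀ k : ℕ, n + 2 * M < k →
          C * ((ν.toMeasure (cyl Y u)).toReal * (ν.toMeasure (cyl Y v)).toReal)
            ≤ (ν.toMeasure (cyl Y u ∩ Y.σ^[k] ⁻¹' cyl Y v)).toReal) ∧
    PreErgodic Y.σ ν.toMeasure := by
  obtain ⟨D, hD, h⟩ : ∃ D : ℝ, 0 < D ∧ ∀ (n l : ℕ) (u : Fin n → B) (v : Fin l → B),
        ∀ k : ℕ, n + 2 * M < k →
          D * ((ν.toMeasure (cyl Y u)).toReal * (ν.toMeasure (cyl Y v)).toReal)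
            ≤ (ν.toMeasure (cyl Y u ∩ Y.σ^[k] ⁻¹' cyl Y v)).toReal := by
    cases M with
    | zero =>
      obtain ⟨D, hD, h⟩ := corr π hXS 0 (mixGap_one hM) hα ν hG
      refine ⟨D, hD, fun n l u v k hk => ?_⟩
      have := h n (k - n) l u v
      rwa [show n + 0 + (k - n + 0) = k by omega] at this
    | succ m =>
      obtain ⟨D, hD, h⟩ := corr π hXS m hM hα ν hG
      refine ⟨D, hD, fun n l u v k hk => ?_⟩
      have := h n (k - n - 2 * m) l u v
      rwa [show n + m + (k - n - 2 * m + m) = k by omega] at this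
  exact ⟨⟨D, hD, fun n l u v _ _ k hk => h n l u v k hk⟩, preErg ν D hD M h⟩
end Paper
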